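/- arXiv:2509.02483 — 2 statements merged into one kernel-verified Lean document; each statement's English description precedes it below -/
import Mathlib

section
/- Let a, b ∈ ℝ² be two radar locations, let C_a, C_b > 0 be their SNR constants, and let both radars share the same false alarm probability p with 0 < p < 1. For any point x ∈ ℝ² with x ≠ a and x ≠ b, the detection probabilities are equal, exp(ln(p)/(C_a/‖x − a‖⁴ + 1)) = exp(ln(p)/(C_b/‖x − b‖⁴ + 1)), if and only if the multiplicatively weighted distances are equal: ‖x − a‖/C_a^{1/4} = ‖x − b‖/C_b^{1/4}. Hence the equal-probability-of-detection boundary between two radars is a multiplicatively weighted Voronoi edge. -/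
theorem equal_pd_boundary_is_weighted_voronoi_edge
    (a b : EuclideanSpace ℝ (Fin 2)) (Ca Cb : ℝ) (hCa : 0 < Ca) (hCb : 0 < Cb)
    (p : ℝ) (hp0 : 0 < p) (hp1 : p < 1)
    (x : EuclideanSpace ℝ (Fin 2)) (hxa : x ≠ a) (hxb : x ≠ b) :
    Real.exp (Real.log p / (Ca / ‖x - a‖ ^ 4 + 1)) =
        Real.exp (Real.log p / (Cb / ‖x - b‖ ^ 4 + 1)) ↔
      ‖x - a‖ / Ca ^ ((1 : ℝ) / 4) = ‖x - b‖ / Cb ^ ((1 : ℝ) / 4) := by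
  have hlog : Real.log p ≠ 0 := (Real.log_neg hp0 hp1).ne
  have root_pow {C : ℝ} (hC : 0 < C) : (C ^ ((1 : ℝ) / 4)) ^ 4 = C := by
    rw [← Real.rpow_natCast, ← Real.rpow_mul hC.le]
    norm_num
  rw [Real.exp_eq_exp, div_eq_mul_inv (Real.log p), div_eq_mul_inv (Real.log p),
    mul_right_inj' hlog, inv_inj, add_left_inj,
    ← pow_left_inj₀ (by positivity : 0 ≤ ‖x - a‖ / Ca ^ ((1 : ℝ) / 4))
      (by positivity) (by norm_num : 4 ≠ 0),
    div_pow, div_pow, root_pow hCa, root_pow hCb, ← inv_inj, inv_div, inv_div]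
end

section
/- Let a, b ∈ ℝ² be radar locations with SNR constants C_a, C_b > 0 and common false alarm probability p ∈ (0,1). Define, for x ∉ {a, b}, the individual detection probabilities P_a(x) = exp(ln(p)/(C_a/‖x − a‖⁴ + 1)) and P_b(x) analogously, and the combined detection probability P(x) = 1 − (1 − P_a(x))(1 − P_b(x)). Suppose x and y both lie on the weighted bisector ‖·−a‖/C_a^{1/4} = ‖·−b‖/C_b^{1/4}, with x ≠ a, y ≠ a, x ≠ b, y ≠ b, and ‖x − a‖ ≤ ‖y − a‖. Then P(x) ≥ P(y). Hence the maximum combined probability of detection along a weighted Voronoi edge is attained at the point of the edge of minimal weighted distance to the generators. -/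
/-- The detection probability is antitone in the distance to the radar. -/
theorem detectionProb_le_of_dist_le {C p r s : ℝ} (hC : 0 ≤ C) (hp0 : 0 ≤ p) (hp1 : p ≤ 1)
    (hr : 0 < r) (hrs : r ≤ s) :
    Real.exp (Real.log p / (C / s ^ 4 + 1)) ≤ Real.exp (Real.log p / (C / r ^ 4 + 1)) := by
  have hlog : 0 ≤ -Real.log p := neg_nonneg.2 (Real.log_nonpos hp0 hp1)
  have hs : 0 < s := hr.trans_le hrs
  have h : -Real.log p / (C / r ^ 4 + 1) ≤ -Real.log p / (C / s ^ 4 + 1) := by gcongr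
  rw [neg_div, neg_div] at h
  exact Real.exp_le_exp.2 (neg_le_neg_iff.1 h)

/-- The detection probability never exceeds one. -/
theorem detectionProb_le_one {C p r : ℝ} (hC : 0 ≤ C) (hp0 : 0 ≤ p) (hp1 : p ≤ 1) :
    Real.exp (Real.log p / (C / r ^ 4 + 1)) ≤ 1 :=
  Real.exp_le_one_iff.2
    (div_nonpos_of_nonpos_of_nonneg (Real.log_nonpos hp0 hp1) (by positivity))


theorem combined_pd_max_at_min_weighted_distance
    (a b : EuclideanSpace ℝ (Fin 2)) (Ca Cb : ℝ) (hCa : 0 < Ca) (hCb : 0 < Cb)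
    (p : ℝ) (hp0 : 0 < p) (hp1 : p < 1)
    (Pa Pb P : EuclideanSpace ℝ (Fin 2) → ℝ)
    (hPa : ∀ x, Pa x = Real.exp (Real.log p / (Ca / ‖x - a‖ ^ 4 + 1)))
    (hPb : ∀ x, Pb x = Real.exp (Real.log p / (Cb / ‖x - b‖ ^ 4 + 1)))
    (hP : ∀ x, P x = 1 - (1 - Pa x) * (1 - Pb x))
    (x y : EuclideanSpace ℝ (Fin 2))
    (hxa : x ≠ a) (hya : y ≠ a) (hxb : x ≠ b) (hyb : y ≠ b)
    (hx : ‖x - a‖ / Ca ^ ((1 : ℝ) / 4) = ‖x - b‖ / Cb ^ ((1 : ℝ) / 4))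
    (hy : ‖y - a‖ / Ca ^ ((1 : ℝ) / 4) = ‖y - b‖ / Cb ^ ((1 : ℝ) / 4))
    (hxy : ‖x - a‖ ≤ ‖y - a‖) :
    P x ≥ P y := by
  have hb : ‖x - b‖ ≤ ‖y - b‖ := by
    have h : ‖x - a‖ / Ca ^ ((1 : ℝ) / 4) ≤ ‖y - a‖ / Ca ^ ((1 : ℝ) / 4) := by gcongr
    rw [hx, hy] at h
    exact (div_le_div_iff_of_pos_right (Real.rpow_pos_of_pos hCb _)).1 h
  have hPa_le : Pa y ≤ Pa x := by
    rw [hPa, hPa]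
    exact detectionProb_le_of_dist_le hCa.le hp0.le hp1.le (norm_sub_pos_iff.2 hxa) hxy
  have hPb_le : Pb y ≤ Pb x := by
    rw [hPb, hPb]
    exact detectionProb_le_of_dist_le hCb.le hp0.le hp1.le (norm_sub_pos_iff.2 hxb) hb
  have hPa_one : Pa y ≤ 1 := hPa y ▸ detectionProb_le_one hCa.le hp0.le hp1.le
  have hPb_one : Pb x ≤ 1 := hPb x ▸ detectionProb_le_one hCb.le hp0.le hp1.le
  rw [ge_iff_le, hP, hP]
  have := mul_le_mul (sub_le_sub_left hPa_le 1) (sub_le_sub_left hPb_le 1)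
    (sub_nonneg.2 hPb_one) (sub_nonneg.2 hPa_one)
  linarith
end
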